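/- Let G be an almost Moore digraph of degree d > 1 and diameter k > 1 with self-repeats, with adjacency matrix A and permutation matrix P of its repeat permutation r, and suppose its permutation cycle structure is (k, …, m_{d−1}, 0, …, 0), i.e. every cycle of r has length at most d − 1. Then for every integer j > 0 and every integer ℓ with 1 ≤ ℓ < (k+1)/(d−1), the trace Tr(P^j A^ℓ) equals 0. -/

import Mathlib

/-- `IsWalkFrom A u v l` : the list `u :: l` is a directed walk from `u` to `v`
along the adjacency relation `A`; the length of the walk is `l.length`. -/
def IsWalkFrom {V : Type} (A : V → V → Prop) (u v : V) (l : List V) : Prop :=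
  List.Chain A u l ∧ (u :: l).getLast (List.cons_ne_nil u l) = v

/-- An almost Moore digraph (a `(d,k)`-digraph): a diregular digraph of degree `d > 1`,
diameter `k > 1` and order `d + d² + ⋯ + d^k`, together with its repeat permutation `rep`:
for every vertex `v`, every vertex `w ≠ rep v` is reached from `v` by exactly one walk of
length at most `k`, while `rep v` is reached by exactly two such walks, at least one of
which has length `k`.  The map `rep` is an automorphism of the digraph. -/
structure AlmostMooreDigraph (d k : ℕ) where
  hd : 1 < d
  hk : 1 < k
  V : Type
  [fintypeV : Fintype V]
  [decEqV : DecidableEq V]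
  Adj : V → V → Prop
  [adjDec : DecidableRel Adj]
  loopless : ∀ v, ¬ Adj v v
  out_deg : ∀ v, {w | Adj v w}.ncard = d
  in_deg : ∀ v, {w | Adj w v}.ncard = d
  reach : ∀ u v, ∃ l, IsWalkFrom Adj u v l ∧ l.length ≤ k
  diam : ∃ u v, ∀ l, IsWalkFrom Adj u v l → k ≤ l.length
  card_eq : Fintype.card V = ∑ i ∈ Finset.range k, d ^ (i + 1)
  rep : V → V
  rep_spec : ∀ v w, w ≠ rep v → ∃! l, IsWalkFrom Adj v w l ∧ l.length ≤ k
  rep_two : ∀ v, ∃ l₁ l₂, l₁ ≠ l₂ ∧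
      IsWalkFrom Adj v (rep v) l₁ ∧ l₁.length ≤ k ∧
      IsWalkFrom Adj v (rep v) l₂ ∧ l₂.length ≤ k ∧
      (l₁.length = k ∨ l₂.length = k) ∧
      (∀ l, IsWalkFrom Adj v (rep v) l → l.length ≤ k → l = l₁ ∨ l = l₂)
  rep_bijective : Function.Bijective rep
  rep_adj : ∀ u v, Adj u v ↔ Adj (rep u) (rep v)

attribute [instance] AlmostMooreDigraph.fintypeV AlmostMooreDigraph.decEqV
  AlmostMooreDigraph.adjDec

/-- `ordRep M v` : the smallest `t ≥ 1` with `rep^t v = v`. -/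
noncomputable def ordRep {d k : ℕ} (M : AlmostMooreDigraph d k) (v : M.V) : ℕ :=
  sInf {t | 0 < t ∧ M.rep^[t] v = v}

/-- The vertex set of the subdigraph `H_α`: vertices whose order under the repeat
permutation divides `2^t * α` for some `t ≥ 0`. -/
def Hset {d k : ℕ} (M : AlmostMooreDigraph d k) (α : ℕ) : Set M.V :=
  {v | ∃ t : ℕ, ordRep M v ∣ 2 ^ t * α}

/-- The adjacency matrix of an almost Moore digraph (with integer entries). -/
def adjMat {d k : ℕ} (M : AlmostMooreDigraph d k) : Matrix M.V M.V ℤ :=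
  Matrix.of fun u w => if M.Adj u w then 1 else 0

/-- The permutation matrix of the repeat permutation `r`. -/
def permMat {d k : ℕ} (M : AlmostMooreDigraph d k) : Matrix M.V M.V ℤ :=
  Matrix.of fun u w => if M.rep u = w then 1 else 0

theorem isWalkFrom_nil_iff {V : Type} {A : V → V → Prop} {u v : V} :
    IsWalkFrom A u v [] ↔ u = v :=
  ⟨fun h => h.2, fun h => ⟨List.isChain_singleton u, h⟩⟩

theorem isWalkFrom_cons_iff {V : Type} {A : V → V → Prop} {u v w : V} {l : List V} :
    IsWalkFrom A u v (w :: l) ↔ A u w ∧ IsWalkFrom A w v l := by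
  unfold IsWalkFrom
  rw [List.getLast_cons_cons, ← and_assoc]
  exact and_congr_left' List.isChain_cons_cons

/-- Directed walks can be concatenated. -/
theorem IsWalkFrom.append {V : Type} {A : V → V → Prop} {u v w : V} {l₁ l₂ : List V}
    (h₁ : IsWalkFrom A u v l₁) (h₂ : IsWalkFrom A v w l₂) : IsWalkFrom A u w (l₁ ++ l₂) := by
  induction l₁ generalizing u with
  | nil =>
    obtain rfl := isWalkFrom_nil_iff.1 h₁
    exact h₂
  | cons a l ih =>
    rw [isWalkFrom_cons_iff] at h₁
    exact isWalkFrom_cons_iff.2 ⟨h₁.1, ih h₁.2⟩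

/-- A relation-preserving map carries walks to walks. -/
theorem IsWalkFrom.map {V : Type} {A : V → V → Prop} {f : V → V}
    (hf : ∀ x y, A x y → A (f x) (f y)) {u v : V} {l : List V}
    (h : IsWalkFrom A u v l) : IsWalkFrom A (f u) (f v) (l.map f) := by
  induction l generalizing u with
  | nil => exact isWalkFrom_nil_iff.2 (congrArg f (isWalkFrom_nil_iff.1 h))
  | cons a l ih =>
    rw [isWalkFrom_cons_iff] at h
    exact isWalkFrom_cons_iff.2 ⟨hf _ _ h.1, ih h.2⟩

/-- If a relation-preserving `f` admits a walk of length `n` from `f v` to `v`, then it admits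
a walk of length `n * t` from `f^[t] v` to `v`. -/
theorem exists_isWalkFrom_iterate {V : Type} {A : V → V → Prop} {f : V → V}
    (hf : ∀ x y, A x y → A (f x) (f y)) {v : V} {l : List V}
    (h : IsWalkFrom A (f v) v l) (t : ℕ) :
    ∃ l', IsWalkFrom A (f^[t] v) v l' ∧ l'.length = l.length * t := by
  induction t with
  | zero => exact ⟨[], isWalkFrom_nil_iff.2 rfl, by simp⟩
  | succ t ih =>
    obtain ⟨l', hl', hlen⟩ := ih
    refine ⟨l'.map f ++ l, ?_, by simp [hlen]; ring⟩
    rw [Function.iterate_succ_apply']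
    exact (hl'.map hf).append h

namespace AlmostMooreDigraph

variable {d k : ℕ} (M : AlmostMooreDigraph d k)

theorem exists_isWalkFrom_of_adjMat_pow_ne_zero (n : ℕ) (u v : M.V)
    (h : (adjMat M ^ n) u v ≠ 0) : ∃ l, IsWalkFrom M.Adj u v l ∧ l.length = n := by
  induction n generalizing u with
  | zero =>
    have huv : u = v := by
      by_contra hne
      exact h (by simp [Matrix.one_apply_ne hne])
    subst huv
    exact ⟨[], isWalkFrom_nil_iff.2 rfl, rfl⟩
  | succ n ih =>
    rw [pow_succ', Matrix.mul_apply] at h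
    obtain ⟨w, -, hw⟩ := Finset.exists_ne_zero_of_sum_ne_zero h
    have hadj : M.Adj u w := by
      by_contra hn
      exact left_ne_zero_of_mul hw (by simp [adjMat, hn])
    obtain ⟨l, hl, hlen⟩ := ih w (right_ne_zero_of_mul hw)
    exact ⟨w :: l, isWalkFrom_cons_iff.2 ⟨hadj, hl⟩, by simp [hlen]⟩

theorem permMat_pow_mul_apply (j : ℕ) (B : Matrix M.V M.V ℤ) (u v : M.V) :
    (permMat M ^ j * B) u v = B (M.rep^[j] u) v := by
  induction j generalizing u with
  | zero => simp
  | succ j ih =>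
    rw [pow_succ', Matrix.mul_assoc, Matrix.mul_apply, Function.iterate_succ_apply]
    simp only [ih]
    simp [permMat]

theorem ordRep_pos_and_iterate (v : M.V) : 0 < ordRep M v ∧ M.rep^[ordRep M v] v = v :=
  Nat.sInf_mem (s := {t | 0 < t ∧ M.rep^[t] v = v})
    (M.rep_bijective.injective.mem_periodicPts v)

theorem adj_iterate (j : ℕ) (x y : M.V) (h : M.Adj x y) :
    M.Adj (M.rep^[j] x) (M.rep^[j] y) := by
  induction j with
  | zero => exact h
  | succ j ih =>
    rw [Function.iterate_succ_apply', Function.iterate_succ_apply']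
    exact (M.rep_adj _ _).1 ih

/-- A nontrivial closed walk of length at most `k` has length exactly `k`, and its base point
is a self-repeat. -/
theorem rep_eq_and_length_eq_of_closed_walk {v : M.V} {l : List M.V}
    (h : IsWalkFrom M.Adj v v l) (hpos : l ≠ []) (hlen : l.length ≤ k) :
    M.rep v = v ∧ l.length = k := by
  have hk := M.hk
  have hrep : M.rep v = v := by
    by_contra hne
    exact hpos ((M.rep_spec v v (Ne.symm hne)).unique ⟨h, hlen⟩
      ⟨isWalkFrom_nil_iff.2 rfl, Nat.zero_le _⟩)
  refine ⟨hrep, ?_⟩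
  obtain ⟨l₁, l₂, -, -, -, -, -, hor, hall⟩ := M.rep_two v
  rw [hrep] at hall
  rcases hall l h hlen with rfl | rfl <;>
  rcases hall [] (isWalkFrom_nil_iff.2 rfl) (Nat.zero_le _) with rfl | rfl <;>
  simp_all <;> omega

theorem lt_card : k < Fintype.card M.V := by
  have hd := M.hd
  have hk := M.hk
  rw [M.card_eq]
  calc k < ∑ i ∈ Finset.range k, 2 := by simp; omega
    _ ≤ ∑ i ∈ Finset.range k, d ^ (i + 1) :=
        Finset.sum_le_sum fun i _ => le_trans hd (Nat.le_self_pow (Nat.succ_ne_zero i) d)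

end AlmostMooreDigraph

/-- Let `G` be an almost Moore digraph with self-repeats, adjacency
matrix `A` and permutation matrix `P` of its repeat permutation, with permutation cycle
structure `(k, …, m_{d−1}, 0, …, 0)` (so every cycle of `r` has length at most `d − 1`).
Then for every `j > 0` and every `ℓ` with `1 ≤ ℓ < (k+1)/(d−1)` (i.e. `ℓ(d−1) < k+1`),
`Tr(P^j A^ℓ) = 0`. -/
theorem stmt13 {d k : ℕ} (M : AlmostMooreDigraph d k) (hsr : ∃ v, M.rep v = v)
    (hm1 : {v | M.rep v = v}.ncard = k)
    (hord : ∀ v : M.V, ordRep M v ≤ d - 1)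
    (j ℓ : ℕ) (hj : 0 < j) (hℓ : 1 ≤ ℓ) (hbound : ℓ * (d - 1) < k + 1) :
    Matrix.trace (permMat M ^ j * adjMat M ^ ℓ) = 0 := by
  rw [Matrix.trace]
  refine Finset.sum_eq_zero fun v _ => ?_
  rw [Matrix.diag_apply, M.permMat_pow_mul_apply]
  by_contra hne
  obtain ⟨l, hl, rfl⟩ := M.exists_isWalkFrom_of_adjMat_pow_ne_zero _ _ _ hne
  have hd := M.hd
  have hk := M.hk
  obtain ⟨hpos, hper⟩ := M.ordRep_pos_and_iterate v
  obtain ⟨c, hc, hclen⟩ := exists_isWalkFrom_iterate (M.adj_iterate j) hl (ordRep M v)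
  rw [← Function.iterate_mul, mul_comm, Function.iterate_mul, Function.iterate_fixed hper] at hc
  have hcpos : c ≠ [] := by
    rw [← List.length_pos_iff, hclen]
    exact Nat.mul_pos hℓ hpos
  have hcle : c.length ≤ k := by
    rw [hclen]
    exact Nat.lt_succ_iff.1 ((Nat.mul_le_mul_left _ (hord v)).trans_lt hbound)
  obtain ⟨hrep, -⟩ := M.rep_eq_and_length_eq_of_closed_walk hc hcpos hcle
  rw [Function.iterate_fixed hrep] at hl
  have hlle : l.length ≤ k :=
    Nat.lt_succ_iff.1 ((Nat.le_mul_of_pos_right _ (by omega)).trans_lt hbound)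
  obtain ⟨-, hlk⟩ := M.rep_eq_and_length_eq_of_closed_walk hl
    (List.length_pos_iff.1 hℓ) hlle
  have hd2 : d = 2 := by
    rw [hlk] at hbound
    by_contra hd2
    have h2 : k * 2 ≤ k * (d - 1) := Nat.mul_le_mul_left k (by omega)
    omega
  have hfix : {v | M.rep v = v} = Set.univ := by
    refine Set.eq_univ_of_forall fun w => ?_
    obtain ⟨hw, hw'⟩ := M.ordRep_pos_and_iterate w
    have h1 : ordRep M w = 1 := by have := hord w; omega
    rw [h1] at hw'
    exact hw'
  rw [hfix, Set.ncard_univ, Nat.card_eq_fintype_card] at hm1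
  exact M.lt_card.ne hm1.symm
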